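/- Fix a compact set S ⊂ ℂ. For τ ∈ ℂ and w > 0 set z(τ, w) = (1 − τ·w^{2/3})/(e·w). Then there is a function η : ℂ × (0,∞) → ℂ such that for all small w > 0 and all τ ∈ S: φ̃(z(τ,w), w) = √(2π) · 2^{1/3} · w^{−1/6} · e^{−1/4} · (Ai(2^{1/3}·τ) + η(τ, w)) · exp(−1/(2w) + τ/w^{1/3}), with sup_{τ ∈ S} ‖η(τ, w)‖ → 0 as w → 0⁺. (Uniform version of φ̃(z, w) ∼ √(2π)·2^{1/3}·w^{−1/6}·e^{−1/4}·Ai(2^{1/3}τ)·exp(−1/(2w) + τ/w^{1/3}).) -/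

import Mathlib

open Filter Topology

/-- The contour `Π(π/3)`. -/
noncomputable def airyPath (φ : ℝ) (s : ℝ) : ℂ :=
  if s ≤ -1 then -Complex.exp (-(φ : ℂ) * Complex.I) * (s : ℂ)
  else if s ≤ 1 then (Real.cos φ : ℂ) + Complex.I * (s : ℂ) * (Real.sin φ : ℂ)
  else Complex.exp ((φ : ℂ) * Complex.I) * (s : ℂ)

/-- The piecewise derivative of the contour `Π(φ)`. -/
noncomputable def airyPathDeriv (φ : ℝ) (s : ℝ) : ℂ :=
  if s ≤ -1 then -Complex.exp (-(φ : ℂ) * Complex.I)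
  else if s ≤ 1 then Complex.I * (Real.sin φ : ℂ)
  else Complex.exp ((φ : ℂ) * Complex.I)

/-- The Airy function `Ai(z) = (1/(2πi)) ∫_{Π(π/3)} e^{−zt + t³/3} dt`. -/
noncomputable def airyAi (z : ℂ) : ℂ :=
  (1 / (2 * (Real.pi : ℂ) * Complex.I)) *
    ∫ s : ℝ, Complex.exp (-z * airyPath (Real.pi / 3) s + (airyPath (Real.pi / 3) s) ^ 3 / 3) *
      airyPathDeriv (Real.pi / 3) s

/-- The deformed exponential for simple digraphs:
`φ̃(z, w) = (2π log(1+w))^{−1/2} ∫_ℝ exp(−x²/(2 log(1+w)) − z √(1+w) e^{−ix}) dx`. -/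
noncomputable def phiTilde (z : ℂ) (w : ℝ) : ℂ :=
  (1 / (Real.sqrt (2 * Real.pi * Real.log (1 + w)) : ℂ)) *
    ∫ x : ℝ, Complex.exp (-(x : ℂ) ^ 2 / (2 * (Real.log (1 + w) : ℂ))
      - z * (Real.sqrt (1 + w) : ℂ) * Complex.exp (-Complex.I * (x : ℂ)))

open MeasureTheory

/-- Two contours whose endpoints approach each other, in the sense that the trivial bound for the
integral of an entire function over the connecting segments tends to zero, give the same
integral. -/
theorem integral_contour_eq {f : ℂ → ℂ} (hf : Differentiable ℂ f) {γ γ' δ δ' : ℝ → ℂ}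
    {C : Set ℝ} (hC : C.Countable) (hγ : Continuous γ) (hδ : Continuous δ)
    (hγ' : ∀ s ∉ C, HasDerivAt γ (γ' s) s) (hδ' : ∀ s ∉ C, HasDerivAt δ (δ' s) s)
    (hγi : Integrable fun s => f (γ s) * γ' s) (hδi : Integrable fun s => f (δ s) * δ' s)
    {B : ℝ → ℝ}
    (hB : ∀ᶠ R in atTop, (∀ x ∈ segment ℝ (δ R) (γ R), ‖f x‖ ≤ B R) ∧
      ∀ x ∈ segment ℝ (δ (-R)) (γ (-R)), ‖f x‖ ≤ B R)
    (hend : Tendsto (fun R => B R * ‖γ R - δ R‖) atTop (𝓝 0))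
    (hstart : Tendsto (fun R => B R * ‖γ (-R) - δ (-R)‖) atTop (𝓝 0)) :
    ∫ s, f (γ s) * γ' s = ∫ s, f (δ s) * δ' s := by
  obtain ⟨G, hG⟩ := hf.isExactOn_univ
  replace hG : ∀ z, HasDerivAt G (f z) z := fun z => hG z (Set.mem_univ z)
  have hGc : Continuous G := continuous_iff_continuousAt.2 fun z => (hG z).continuousAt
  have ftc : ∀ {α α' : ℝ → ℂ}, Continuous α → (∀ s ∉ C, HasDerivAt α (α' s) s) →
      Integrable (fun s => f (α s) * α' s) → ∀ R : ℝ,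
      ∫ s in (-R)..R, f (α s) * α' s = G (α R) - G (α (-R)) := by
    intro α α' hα hα' hi R
    refine integral_eq_of_hasDerivAt_off_countable (fun s => G (α s)) _ hC
      (hGc.comp hα).continuousOn (fun s hs => ?_) hi.intervalIntegrable
    exact (hG (α s)).comp s (hα' s hs.2)
  have mv : ∀ p q : ℂ, ∀ b : ℝ, (∀ x ∈ segment ℝ p q, ‖f x‖ ≤ b) →
      ‖G q - G p‖ ≤ b * ‖q - p‖ := fun p q b hb =>
    (convex_segment p q).norm_image_sub_le_of_norm_hasDerivWithin_le
      (fun x _ => (hG x).hasDerivWithinAt) hb (left_mem_segment ℝ p q) (right_mem_segment ℝ p q)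
  have h1 := intervalIntegral_tendsto_integral hγi tendsto_neg_atTop_atBot tendsto_id
  have h2 := intervalIntegral_tendsto_integral hδi tendsto_neg_atTop_atBot tendsto_id
  refine sub_eq_zero.1 (tendsto_nhds_unique (h1.sub h2) ?_)
  refine squeeze_zero_norm' ?_ (by simpa using hend.add hstart)
  filter_upwards [hB] with R hR
  simp only [id]
  rw [ftc hγ hγ' hγi, ftc hδ hδ' hδi]
  calc ‖G (γ R) - G (γ (-R)) - (G (δ R) - G (δ (-R)))‖
      = ‖(G (γ R) - G (δ R)) - (G (γ (-R)) - G (δ (-R)))‖ := by ring_nf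
    _ ≤ _ := (norm_sub_le _ _).trans (add_le_add (mv _ _ _ hR.1) (mv _ _ _ hR.2))

/-- A Gaussian dominates the exponential of a linear function. -/
theorem integrable_exp_sub_mul_sq (A B : ℝ) {c : ℝ} (hc : 0 < c) :
    Integrable fun s : ℝ => Real.exp (A + B * |s| - c * s ^ 2) := by
  refine ((integrable_exp_neg_mul_sq (half_pos hc)).const_mul
    (Real.exp (A + B ^ 2 / (2 * c)))).mono' (by fun_prop) (ae_of_all _ fun s => ?_)
  rw [Real.norm_eq_abs, Real.abs_exp, ← Real.exp_add, Real.exp_le_exp]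
  have h : B * |s| ≤ B ^ 2 / (2 * c) + c / 2 * s ^ 2 := by
    rw [← sq_abs s, div_add' _ _ _ (by positivity), le_div_iff₀ (by positivity)]
    nlinarith [sq_nonneg (B - c * |s|)]
  linarith

theorem tendsto_exp_mul_sub_mul_sq (B : ℝ) {c : ℝ} (hc : 0 < c) :
    Tendsto (fun R : ℝ => Real.exp (B * R - c * R ^ 2)) atTop (𝓝 0) := by
  refine Real.tendsto_exp_atBot.comp ?_
  have h : Tendsto (fun R : ℝ => R * (B - c * R)) atTop atBot :=
    tendsto_id.atTop_mul_atBot₀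
      (tendsto_atBot_add_const_left _ B (tendsto_neg_atTop_atBot.comp
        (tendsto_id.const_mul_atTop hc)))
  exact h.congr fun R => by ring

theorem continuous_airyPath (φ : ℝ) : Continuous (airyPath φ) := by
  unfold airyPath
  refine Continuous.if_le (by fun_prop) (Continuous.if_le (by fun_prop) (by fun_prop)
    continuous_id continuous_const ?_) continuous_id continuous_const ?_
  · rintro s rfl
    rw [Complex.exp_mul_I]
    simp [mul_comm]
  · rintro s rfl
    norm_num
    rw [← neg_mul, ← Complex.ofReal_neg, Complex.exp_mul_I]
    simp [mul_comm]

theorem hasDerivAt_airyPath (φ : ℝ) {s : ℝ} (hs : s ∉ ({-1, 1} : Set ℝ)) :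
    HasDerivAt (airyPath φ) (airyPathDeriv φ s) s := by
  have hs1 : s ≠ -1 := fun h => hs (by simp [h])
  have hs2 : s ≠ 1 := fun h => hs (by simp [h])
  have hid : HasDerivAt (fun x : ℝ => (x : ℂ)) 1 s := Complex.ofRealCLM.hasDerivAt
  unfold airyPathDeriv
  rcases lt_or_gt_of_ne hs1 with h1 | h1
  · rw [if_pos h1.le]
    refine (by simpa using hid.const_mul (-Complex.exp (-(φ : ℂ) * Complex.I)) :
      HasDerivAt (fun x : ℝ => -Complex.exp (-(φ : ℂ) * Complex.I) * (x : ℂ)) _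
          s).congr_of_eventuallyEq ?_
    filter_upwards [gt_mem_nhds h1] with x hx
    simp [airyPath, hx.le]
  · rw [if_neg h1.not_ge]
    rcases lt_or_gt_of_ne hs2 with h2 | h2
    · rw [if_pos h2.le]
      refine (by
        simpa using ((hid.const_mul Complex.I).mul_const (Real.sin φ : ℂ)).const_add (Real.cos φ : ℂ) :
        HasDerivAt (fun x : ℝ => (Real.cos φ : ℂ) + Complex.I * (x : ℂ) * (Real.sin φ : ℂ)) _
          s).congr_of_eventuallyEq ?_
      filter_upwards [gt_mem_nhds h2, lt_mem_nhds h1] with x hx hx'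
      simp [airyPath, hx.le, hx'.not_ge]
    · rw [if_neg h2.not_ge]
      refine (by simpa using hid.const_mul (Complex.exp ((φ : ℂ) * Complex.I)) :
        HasDerivAt (fun x : ℝ => Complex.exp ((φ : ℂ) * Complex.I) * (x : ℂ)) _
          s).congr_of_eventuallyEq ?_
      filter_upwards [lt_mem_nhds h2, lt_mem_nhds h1] with x hx hx'
      simp [airyPath, hx.not_ge, hx'.not_ge]

theorem norm_airyIntegrand_le (z t : ℂ) :
    ‖Complex.exp (-z * t + t ^ 3 / 3)‖ ≤
      Real.exp (‖z‖ * ‖t‖ + (t.re ^ 3 / 3 - t.re * t.im ^ 2)) := by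
  rw [Complex.norm_exp, Real.exp_le_exp, Complex.add_re]
  refine add_le_add ?_ (le_of_eq ?_)
  · calc (-z * t).re ≤ ‖-z * t‖ := Complex.re_le_norm _
      _ = ‖z‖ * ‖t‖ := by rw [norm_mul, norm_neg]
  · have : (3 : ℂ) = ((3 : ℝ) : ℂ) := by norm_num
    rw [this, Complex.div_ofReal_re]
    simp [pow_succ, Complex.mul_re, Complex.mul_im]
    ring

theorem airyPath_pi_div_three (s : ℝ) :
    airyPath (Real.pi / 3) s =
      ((max |s| 1 / 2 : ℝ) : ℂ) + ((s * (√3 / 2) : ℝ) : ℂ) * Complex.I := by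
  have h1 : Complex.exp (((Real.pi / 3 : ℝ) : ℂ) * Complex.I) =
      ((1 / 2 : ℝ) : ℂ) + ((√3 / 2 : ℝ) : ℂ) * Complex.I := by
    rw [Complex.exp_mul_I, ← Complex.ofReal_cos, ← Complex.ofReal_sin, Real.cos_pi_div_three,
      Real.sin_pi_div_three]
  have h2 : Complex.exp (-((Real.pi / 3 : ℝ) : ℂ) * Complex.I) =
      ((1 / 2 : ℝ) : ℂ) - ((√3 / 2 : ℝ) : ℂ) * Complex.I := by
    rw [← Complex.ofReal_neg, Complex.exp_mul_I, ← Complex.ofReal_cos, ← Complex.ofReal_sin,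
      Real.cos_neg, Real.sin_neg, Real.cos_pi_div_three, Real.sin_pi_div_three]
    push_cast
    ring
  unfold airyPath
  split_ifs with h h'
  · rw [h2, max_eq_left (by rw [abs_of_neg (by linarith)]; linarith), abs_of_neg (by linarith)]
    push_cast
    ring
  · rw [max_eq_right (abs_le.2 ⟨by linarith, h'⟩), Real.cos_pi_div_three, Real.sin_pi_div_three]
    push_cast
    ring
  · rw [h1, max_eq_left (by rw [abs_of_pos (by linarith)]; linarith), abs_of_pos (by linarith)]
    push_cast
    ring

theorem norm_airyPathDeriv_le (φ s : ℝ) : ‖airyPathDeriv φ s‖ ≤ 1 := by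
  unfold airyPathDeriv
  split_ifs
  · rw [norm_neg, ← Complex.ofReal_neg, Complex.norm_exp_ofReal_mul_I]
  · rw [norm_mul, Complex.norm_I, one_mul, Complex.norm_real]
    exact Real.abs_sin_le_one φ
  · rw [Complex.norm_exp_ofReal_mul_I]

theorem measurable_airyPathDeriv (φ : ℝ) : Measurable (airyPathDeriv φ) :=
  measurable_const.ite measurableSet_Iic (measurable_const.ite measurableSet_Iic measurable_const)

theorem integrable_airyIntegrand (z : ℂ) :
    Integrable fun s : ℝ => Complex.exp (-z * airyPath (Real.pi / 3) s +
      airyPath (Real.pi / 3) s ^ 3 / 3) * airyPathDeriv (Real.pi / 3) s := by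
  have hc := continuous_airyPath (Real.pi / 3)
  refine (integrable_exp_sub_mul_sq (‖z‖ + 1) (2 * ‖z‖) (c := 1 / 3) (by norm_num)).mono'
    (((by fun_prop : Continuous fun s : ℝ => Complex.exp (-z * airyPath (Real.pi / 3) s +
      airyPath (Real.pi / 3) s ^ 3 / 3)).measurable.mul
        (measurable_airyPathDeriv _)).aestronglyMeasurable) (ae_of_all _ fun s => ?_)
  rw [norm_mul]
  refine (mul_le_of_le_one_right (norm_nonneg _) (norm_airyPathDeriv_le _ s)).trans ?_
  refine (norm_airyIntegrand_le z _).trans (Real.exp_le_exp.2 ?_)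
  have h3 : √3 ^ 2 = 3 := Real.sq_sqrt (by norm_num)
  have h3' : √3 ≤ 2 := by rw [Real.sqrt_le_left (by norm_num)]; norm_num
  have hre : (airyPath (Real.pi / 3) s).re = max |s| 1 / 2 := by simp [airyPath_pi_div_three]
  have him : (airyPath (Real.pi / 3) s).im = s * (√3 / 2) := by simp [airyPath_pi_div_three]
  have hnorm : ‖airyPath (Real.pi / 3) s‖ ≤ 1 + 2 * |s| := by
    refine (Complex.norm_le_abs_re_add_abs_im _).trans ?_
    have hm : max |s| 1 ≤ 1 + |s| := max_le (by linarith) (by linarith [abs_nonneg s])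
    rw [hre, him, abs_of_nonneg (by positivity), abs_mul,
      abs_of_nonneg (by positivity : 0 ≤ √3 / 2)]
    nlinarith [abs_nonneg s]
  have hcube : (max |s| 1 / 2) ^ 3 / 3 - max |s| 1 / 2 * (s * (√3 / 2)) ^ 2 ≤
      1 - 1 / 3 * s ^ 2 := by
    rw [mul_pow, div_pow √3, h3]
    rcases le_total |s| 1 with h | h
    · rw [max_eq_right h]
      nlinarith [sq_nonneg s]
    · rw [max_eq_left h, ← sq_abs s]
      nlinarith [sq_nonneg |s|]
  rw [hre, him]
  nlinarith [mul_le_mul_of_nonneg_left hnorm (norm_nonneg z)]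

theorem continuous_airyLine (z : ℂ) : Continuous fun s : ℝ =>
    Complex.exp (-z * (1 / 2 + s * Complex.I) + (1 / 2 + s * Complex.I) ^ 3 / 3) := by
  fun_prop

theorem norm_airyLine_le (z : ℂ) (s : ℝ) :
    ‖Complex.exp (-z * (1 / 2 + s * Complex.I) + (1 / 2 + s * Complex.I) ^ 3 / 3)‖ ≤
      Real.exp (‖z‖ + 1 + ‖z‖ * |s| - 1 / 2 * s ^ 2) := by
  refine (norm_airyIntegrand_le z _).trans (Real.exp_le_exp.2 ?_)
  have hre : (1 / 2 + s * Complex.I : ℂ).re = 1 / 2 := by simp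
  have him : (1 / 2 + s * Complex.I : ℂ).im = s := by simp
  have hnorm : ‖(1 / 2 + s * Complex.I : ℂ)‖ ≤ 1 + |s| := by
    refine (Complex.norm_le_abs_re_add_abs_im _).trans ?_
    rw [hre, him, abs_of_pos (by norm_num)]
    linarith
  rw [hre, him]
  nlinarith [mul_le_mul_of_nonneg_left hnorm (norm_nonneg z)]

theorem integrable_airyLine (z : ℂ) : Integrable fun s : ℝ =>
    Complex.exp (-z * (1 / 2 + s * Complex.I) + (1 / 2 + s * Complex.I) ^ 3 / 3) :=
  (integrable_exp_sub_mul_sq (‖z‖ + 1) ‖z‖ (c := 1 / 2) (by norm_num)).mono'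
    (continuous_airyLine z).aestronglyMeasurable (ae_of_all _ fun s => norm_airyLine_le z s)

theorem norm_airyIntegrand_le_of_mem_segment (z : ℂ) {R s : ℝ} (hR : 1 ≤ R) (hs : |s| = R) {x : ℂ}
    (hx : x ∈ segment ℝ (1 / 2 + ((√3 / 2 * s : ℝ) : ℂ) * Complex.I) (airyPath (Real.pi / 3) s)) :
    ‖Complex.exp (-z * x + x ^ 3 / 3)‖ ≤ Real.exp (2 * ‖z‖ * R - 1 / 3 * R ^ 2) := by
  have h3 : √3 ^ 2 = 3 := Real.sq_sqrt (by norm_num)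
  have h3' : √3 ≤ 2 := by rw [Real.sqrt_le_left (by norm_num)]; norm_num
  obtain ⟨a, b, ha, hb, hab, rfl⟩ := hx
  rw [airyPath_pi_div_three, hs, max_eq_left hR]
  set x : ℂ := a • (1 / 2 + ((√3 / 2 * s : ℝ) : ℂ) * Complex.I) +
    b • (((R / 2 : ℝ) : ℂ) + ((s * (√3 / 2) : ℝ) : ℂ) * Complex.I) with hx
  have hre : x.re = a / 2 + b * (R / 2) := by
    simp [hx]
    ring
  have him : x.im = s * (√3 / 2) := by
    simp [hx]
    linear_combination (s * (√3 / 2)) * hab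
  have hre1 : 1 / 2 ≤ x.re := by rw [hre]; nlinarith
  have hre2 : x.re ≤ R / 2 := by rw [hre]; nlinarith
  have him2 : x.im ^ 2 = 3 / 4 * R ^ 2 := by
    rw [him, mul_pow, div_pow, h3, ← sq_abs s, hs]
    ring
  have hnorm : ‖x‖ ≤ 2 * R := by
    refine (Complex.norm_le_abs_re_add_abs_im _).trans ?_
    rw [abs_of_nonneg (by linarith : 0 ≤ x.re), him, abs_mul, hs,
      abs_of_nonneg (by positivity : 0 ≤ √3 / 2)]
    nlinarith
  refine (norm_airyIntegrand_le z x).trans (Real.exp_le_exp.2 ?_)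
  have hsq : x.re ^ 2 ≤ R ^ 2 / 4 := by nlinarith
  have hcube : x.re ^ 3 ≤ x.re * (R ^ 2 / 4) := by
    rw [pow_succ']
    exact mul_le_mul_of_nonneg_left hsq (by linarith)
  rw [him2]
  nlinarith [mul_le_mul_of_nonneg_left hnorm (norm_nonneg z), sq_nonneg R,
    mul_le_mul_of_nonneg_right hre1 (sq_nonneg R)]

/-- The Airy integral may be taken over the vertical line `Re t = 1/2`. -/
theorem airyAi_eq_integral_line (z : ℂ) :
    airyAi z = (1 / (2 * (Real.pi : ℂ))) * ∫ s : ℝ,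
      Complex.exp (-z * (1 / 2 + s * Complex.I) + (1 / 2 + s * Complex.I) ^ 3 / 3) := by
  have h3 : 0 < √3 / 2 := by positivity
  have hdiff : Differentiable ℂ fun t : ℂ => Complex.exp (-z * t + t ^ 3 / 3) := by fun_prop
  have hlim : ∀ σ : ℝ, |σ| = 1 → Tendsto (fun R : ℝ => Real.exp (2 * ‖z‖ * R - 1 / 3 * R ^ 2) *
      ‖airyPath (Real.pi / 3) (σ * R) - (1 / 2 + ((√3 / 2 * (σ * R) : ℝ) : ℂ) * Complex.I)‖) atTop
      (𝓝 0) := by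
    intro σ hσ
    refine squeeze_zero' (Eventually.of_forall fun R => by positivity) ?_
      (tendsto_exp_mul_sub_mul_sq (2 * ‖z‖ + 1) (c := 1 / 3) (by norm_num))
    filter_upwards [eventually_ge_atTop 1] with R hR
    have habs : |σ * R| = R := by rw [abs_mul, hσ, one_mul, abs_of_pos (by linarith)]
    have hsub : airyPath (Real.pi / 3) (σ * R) -
        (1 / 2 + ((√3 / 2 * (σ * R) : ℝ) : ℂ) * Complex.I) = (((R - 1) / 2 : ℝ) : ℂ) := by
      rw [airyPath_pi_div_three, habs, max_eq_left hR]
      push_cast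
      ring
    rw [hsub, Complex.norm_real, Real.norm_eq_abs, abs_of_nonneg (by linarith),
      show (2 * ‖z‖ + 1) * R - 1 / 3 * R ^ 2 = (2 * ‖z‖ * R - 1 / 3 * R ^ 2) + R by ring,
      Real.exp_add]
    have := Real.add_one_le_exp R
    gcongr
    linarith
  have key := integral_contour_eq hdiff (Set.toFinite ({-1, 1} : Set ℝ)).countable
    (continuous_airyPath (Real.pi / 3))
    (δ := fun s : ℝ => 1 / 2 + ((√3 / 2 * s : ℝ) : ℂ) * Complex.I)
    (δ' := fun _ => ((√3 / 2 : ℝ) : ℂ) * Complex.I) (by fun_prop)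
    (fun s hs => hasDerivAt_airyPath _ hs)
    (fun s _ => by
      have := (((hasDerivAt_id s).const_mul (√3 / 2)).ofReal_comp.mul_const
        Complex.I).const_add (1 / 2 : ℂ)
      simpa using this)
    (integrable_airyIntegrand z)
    (((integrable_airyLine z).comp_mul_left' h3.ne').mul_const _)
    (B := fun R => Real.exp (2 * ‖z‖ * R - 1 / 3 * R ^ 2))
    (by
      filter_upwards [eventually_ge_atTop 1] with R hR
      exact ⟨fun x hx => norm_airyIntegrand_le_of_mem_segment z hR (abs_of_pos (by linarith)) hx,
        fun x hx => norm_airyIntegrand_le_of_mem_segment z hR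
          (by rw [abs_neg, abs_of_pos (by linarith)]) hx⟩)
    (by simpa using hlim 1 (by simp)) (by simpa using hlim (-1) (by simp))
  rw [airyAi, key, integral_mul_const, Measure.integral_comp_mul_left (fun s : ℝ =>
    Complex.exp (-z * (1 / 2 + s * Complex.I) + (1 / 2 + s * Complex.I) ^ 3 / 3)),
    abs_of_pos (inv_pos.2 h3), Complex.real_smul, Complex.ofReal_inv]
  have h3c : ((√3 / 2 : ℝ) : ℂ) ≠ 0 := by exact_mod_cast h3.ne'
  have hpi : (Real.pi : ℂ) ≠ 0 := by exact_mod_cast Real.pi_ne_zero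
  field_simp

theorem norm_phiTildeIntegrand_le {L : ℝ} (hL : 0 < L) (Z : ℂ) {b : ℝ} {x : ℂ} (hx : |x.im| ≤ |b|) :
    ‖Complex.exp (-x ^ 2 / (2 * (L : ℂ)) - Z * Complex.exp (-Complex.I * x))‖ ≤
      Real.exp (b ^ 2 / (2 * L) + ‖Z‖ * Real.exp |b| + 0 * |x.re| - 1 / (2 * L) * x.re ^ 2) := by
  rw [Complex.norm_exp, Real.exp_le_exp, Complex.sub_re]
  have h1 : (-x ^ 2 / (2 * (L : ℂ))).re = (x.im ^ 2 - x.re ^ 2) / (2 * L) := by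
    rw [show (2 * (L : ℂ)) = ((2 * L : ℝ) : ℂ) by push_cast; ring, Complex.div_ofReal_re]
    simp [pow_two, Complex.mul_re]
  have h2 : -(Z * Complex.exp (-Complex.I * x)).re ≤ ‖Z‖ * Real.exp |b| := by
    rw [← Complex.neg_re]
    refine (Complex.re_le_norm _).trans ?_
    rw [norm_neg, norm_mul, Complex.norm_exp]
    gcongr
    simpa using (le_abs_self _).trans hx
  have h3 : x.im ^ 2 / (2 * L) ≤ b ^ 2 / (2 * L) := by
    gcongr ?_ / _
    exact sq_le_sq.2 hx
  rw [h1, sub_div]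
  linarith [show 1 / (2 * L) * x.re ^ 2 = x.re ^ 2 / (2 * L) by ring]

/-- The integral defining `phiTilde` may be taken over any horizontal line. -/
theorem integral_phiTildeIntegrand_eq_shift {L : ℝ} (hL : 0 < L) (Z : ℂ) (b : ℝ) :
    ∫ x : ℝ, Complex.exp (-(x : ℂ) ^ 2 / (2 * (L : ℂ)) - Z * Complex.exp (-Complex.I * (x : ℂ))) =
      ∫ x : ℝ, Complex.exp (-((x : ℂ) + b * Complex.I) ^ 2 / (2 * (L : ℂ)) -
        Z * Complex.exp (-Complex.I * ((x : ℂ) + b * Complex.I))) := by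
  have hint : ∀ c : ℝ, Integrable fun x : ℝ =>
      Complex.exp (-((x : ℂ) + c * Complex.I) ^ 2 / (2 * (L : ℂ)) -
        Z * Complex.exp (-Complex.I * ((x : ℂ) + c * Complex.I))) := by
    intro c
    refine (integrable_exp_sub_mul_sq (c ^ 2 / (2 * L) + ‖Z‖ * Real.exp |c|) 0
      (c := 1 / (2 * L)) (by positivity)).mono' (by fun_prop) (ae_of_all _ fun s => ?_)
    simpa using norm_phiTildeIntegrand_le hL Z (b := c) (x := (s : ℂ) + c * Complex.I) (by simp)
  have hseg : ∀ R : ℝ, ∀ x ∈ segment ℝ ((R : ℂ) + b * Complex.I) (R : ℂ),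
      x.re = R ∧ |x.im| ≤ |b| := by
    rintro R x ⟨p, q, hp, hq, hpq, rfl⟩
    constructor
    · simp
      linear_combination R * hpq
    · simp [abs_mul, abs_of_nonneg hp]
      nlinarith [abs_nonneg b]
  have hlim : Tendsto (fun R : ℝ => Real.exp (b ^ 2 / (2 * L) + ‖Z‖ * Real.exp |b| + 0 * |R| -
      1 / (2 * L) * R ^ 2) * |b|) atTop (𝓝 0) := by
    have h := ((tendsto_exp_mul_sub_mul_sq 0 (c := 1 / (2 * L)) (by positivity)).const_mul
      (Real.exp (b ^ 2 / (2 * L) + ‖Z‖ * Real.exp |b|))).mul_const |b|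
    simp only [mul_zero, zero_mul, ← Real.exp_add] at h
    refine h.congr fun R => ?_
    ring_nf
  have key := integral_contour_eq
    (f := fun x => Complex.exp (-x ^ 2 / (2 * (L : ℂ)) - Z * Complex.exp (-Complex.I * x)))
    (by fun_prop) Set.countable_empty (γ := fun s : ℝ => (s : ℂ)) (γ' := fun _ => 1)
    (δ := fun s : ℝ => (s : ℂ) + b * Complex.I) (δ' := fun _ => 1) (by fun_prop) (by fun_prop)
    (fun s _ => Complex.ofRealCLM.hasDerivAt)
    (fun s _ => (Complex.ofRealCLM.hasDerivAt (x := s)).add_const _)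
    (by simpa using hint 0) (by simpa using hint b)
    (B := fun R => Real.exp (b ^ 2 / (2 * L) + ‖Z‖ * Real.exp |b| + 0 * |R| -
      1 / (2 * L) * R ^ 2))
    (Eventually.of_forall fun R => ⟨fun x hx => ?_, fun x hx => ?_⟩)
    (by simpa using hlim) (by simpa using hlim)
  · simpa using key
  · have h := hseg R x hx
    simpa [h.1] using norm_phiTildeIntegrand_le hL Z h.2
  · have h := hseg (-R) x hx
    simpa [h.1] using norm_phiTildeIntegrand_le hL Z h.2

/-- The part of the rescaled exponent that does not depend on `τ`. -/
noncomputable def saddleExponent (k h : ℝ) (t : ℂ) : ℂ :=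
  (k * h * t - 1) ^ 2 / (2 * (Real.log (1 + h ^ 3) : ℂ)) + 1 / (2 * (h : ℂ) ^ 3) -
    (√(1 + h ^ 3) : ℂ) * Complex.exp (-(k * h * t)) / (h : ℂ) ^ 3

/-- The coefficient of `τ` in the rescaled exponent. -/
noncomputable def saddleSlope (k h : ℝ) (t : ℂ) : ℂ :=
  ((√(1 + h ^ 3) : ℂ) * Complex.exp (-(k * h * t)) - 1) / (h : ℂ)

theorem phiTilde_eq_integral_saddle {k h : ℝ} (hk : 0 < k) (hh : 0 < h) (τ : ℂ) :
    phiTilde ((1 - τ * (h : ℂ) ^ 2) / ((Real.exp 1 * h ^ 3 : ℝ) : ℂ)) (h ^ 3) =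
      (1 / (√(2 * Real.pi * Real.log (1 + h ^ 3)) : ℂ)) * ((k * h : ℂ) *
        (Complex.exp (-1 / (2 * (h : ℂ) ^ 3) + τ / h) * ∫ s : ℝ,
          Complex.exp (saddleExponent k h (1 / 2 + s * Complex.I) +
            τ * saddleSlope k h (1 / 2 + s * Complex.I)))) := by
  have hL : 0 < Real.log (1 + h ^ 3) := Real.log_pos (by linarith [pow_pos hh 3])
  have hκ : 0 < k * h := mul_pos hk hh
  have hhc : (h : ℂ) ≠ 0 := by exact_mod_cast hh.ne'
  have hLc : (Real.log (1 + h ^ 3) : ℂ) ≠ 0 := by exact_mod_cast hL.ne'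
  unfold phiTilde
  rw [integral_phiTildeIntegrand_eq_shift hL _ (1 - k * h / 2)]
  congr 1
  set g : ℝ → ℂ := fun x => Complex.exp (-((x : ℂ) + ((1 - k * h / 2 : ℝ) : ℂ) * Complex.I) ^ 2 /
    (2 * (Real.log (1 + h ^ 3) : ℂ)) - (1 - τ * (h : ℂ) ^ 2) / ((Real.exp 1 * h ^ 3 : ℝ) : ℂ) *
      (√(1 + h ^ 3) : ℂ) *
      Complex.exp (-Complex.I * ((x : ℂ) + ((1 - k * h / 2 : ℝ) : ℂ) * Complex.I))) with hg
  have hscale : ∫ x, g x = (k * h : ℂ) * ∫ s, g (k * h * s) := by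
    have hκc : (k * h : ℂ) ≠ 0 := by exact_mod_cast hκ.ne'
    rw [Measure.integral_comp_mul_left g, abs_of_pos (inv_pos.2 hκ), Complex.real_smul]
    push_cast
    rw [mul_inv_cancel_left₀ hκc]
  rw [hscale]
  congr 1
  rw [← integral_const_mul]
  refine integral_congr_ae (ae_of_all _ fun s => ?_)
  beta_reduce
  rw [hg, ← Complex.exp_add]
  have hexp : Complex.exp (-Complex.I * (((k * h * s : ℝ) : ℂ) +
      ((1 - k * h / 2 : ℝ) : ℂ) * Complex.I)) =
      Complex.exp 1 * Complex.exp (-(k * h * (1 / 2 + s * Complex.I))) := by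
    rw [← Complex.exp_add]
    congr 1
    push_cast
    linear_combination (-(1 - k * h / 2) : ℂ) * Complex.I_sq
  have hsq : -((((k * h * s : ℝ) : ℂ) + ((1 - k * h / 2 : ℝ) : ℂ) * Complex.I)) ^ 2 =
      (k * h * (1 / 2 + s * Complex.I) - 1 : ℂ) ^ 2 := by
    push_cast
    linear_combination (-((1 - k * h / 2) ^ 2 + (k * h * s) ^ 2) : ℂ) * Complex.I_sq
  simp only [hexp, hsq, saddleExponent, saddleSlope]
  congr 1
  have he : Complex.exp 1 ≠ 0 := Complex.exp_ne_zero 1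
  push_cast
  field_simp
  ring

theorem hasDerivAt_sqrt_one_add_zero : HasDerivAt (fun w : ℝ => √(1 + w)) (1 / 2) 0 := by
  have h := ((hasDerivAt_id (0 : ℝ)).const_add 1).sqrt (by simp)
  simpa using h

theorem tendsto_saddleSlope (k : ℝ) (t : ℂ) :
    Tendsto (fun h => saddleSlope k h t) (𝓝[>] 0) (𝓝 (-(k * t))) := by
  have hid : HasDerivAt (fun x : ℝ => (x : ℂ)) 1 0 := Complex.ofRealCLM.hasDerivAt
  have h1 : HasDerivAt (fun h : ℝ => √(1 + h ^ 3)) 0 0 := by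
    have h := ((hasDerivAt_pow 3 (0 : ℝ)).const_add 1).sqrt (by simp)
    simpa using h
  have h2 := h1.ofReal_comp.mul (((hid.const_mul (k : ℂ)).mul_const t).neg.cexp)
  have h3 := h2.tendsto_slope_zero_right
  simp only [Pi.mul_apply] at h3
  refine Tendsto.congr' ?_ (by simpa using h3)
  filter_upwards with h
  simp [saddleSlope, div_eq_inv_mul]

theorem tendsto_inv_log_one_add_sub_inv :
    Tendsto (fun w : ℝ => 1 / Real.log (1 + w) - 1 / w) (𝓝[>] 0) (𝓝 (1 / 2)) := by
  have h1 : Tendsto (fun w : ℝ => Real.log (1 + w) / w) (𝓝[>] 0) (𝓝 1) := by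
    have h := ((hasDerivAt_id (0 : ℝ)).const_add 1).log (by simp)
    have h' := h.tendsto_slope_zero_right
    refine (by simpa using h' : Tendsto _ _ (𝓝 (1 : ℝ))).congr fun w => ?_
    simp [div_eq_inv_mul]
  have h2 : Tendsto (fun w : ℝ => (w - Real.log (1 + w)) / w ^ 2) (𝓝[>] 0) (𝓝 (1 / 2)) := by
    rw [tendsto_iff_norm_sub_tendsto_zero]
    have h0 : Tendsto (fun w : ℝ => 2 * w) (𝓝[>] 0) (𝓝 0) := by
      have : Tendsto (fun w : ℝ => 2 * w) (𝓝 0) (𝓝 (2 * 0)) := 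
        (continuous_const.mul continuous_id).tendsto 0
      simpa using this.mono_left nhdsWithin_le_nhds
    refine squeeze_zero' (Eventually.of_forall fun w => norm_nonneg _) ?_ h0
    filter_upwards [Ioo_mem_nhdsGT (by norm_num : (0 : ℝ) < 1 / 2)] with w hw
    have hw0 : 0 < w := hw.1
    have hw1 : w < 1 / 2 := hw.2
    have h := Real.abs_log_sub_add_sum_range_le (x := -w)
      (by rw [abs_neg, abs_of_pos hw0]; linarith) 2
    simp only [Finset.sum_range_succ, Finset.sum_range_zero, abs_neg, abs_of_pos hw0] at h
    rw [Real.norm_eq_abs, show (w - Real.log (1 + w)) / w ^ 2 - 1 / 2 =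
      -((0 + (-w) ^ (0 + 1) / ((0 : ℕ) + 1) + (-w) ^ (1 + 1) / ((1 : ℕ) + 1) +
        Real.log (1 - -w)) / w ^ 2) by
      rw [sub_neg_eq_add]
      field_simp
      push_cast
      ring, abs_neg, abs_div, abs_of_pos (by positivity : 0 < w ^ 2), div_le_iff₀ (by positivity)]
    refine h.trans ?_
    rw [div_le_iff₀ (by linarith)]
    have := mul_pos (pow_pos hw0 3) (by linarith : 0 < 1 - 2 * w)
    linarith [show 2 * w * w ^ 2 * (1 - w) - w ^ (2 + 1) = w ^ 3 * (1 - 2 * w) by ring]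
  have h3 := h2.div h1 one_ne_zero
  rw [div_one] at h3
  refine h3.congr' ?_
  filter_upwards [self_mem_nhdsWithin] with w hw
  have hw0 : 0 < w := hw
  have hL : 0 < Real.log (1 + w) := Real.log_pos (by linarith)
  simp only [Pi.div_apply]
  field_simp

theorem tendsto_pow_nhdsGT_zero {n : ℕ} (hn : n ≠ 0) :
    Tendsto (fun h : ℝ => h ^ n) (𝓝[>] 0) (𝓝[>] 0) := by
  refine tendsto_nhdsWithin_iff.2 ⟨?_, ?_⟩
  · have : Tendsto (fun h : ℝ => h ^ n) (𝓝 0) (𝓝 (0 ^ n)) := (continuous_pow n).tendsto 0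
    rw [zero_pow hn] at this
    exact this.mono_left nhdsWithin_le_nhds
  · filter_upwards [self_mem_nhdsWithin] with h hh
    exact pow_pos (Set.mem_Ioi.1 hh) n

theorem tendsto_saddleExponent (k : ℝ) (t : ℂ) :
    Tendsto (fun h => saddleExponent k h t) (𝓝[>] 0) (𝓝 ((k * t) ^ 3 / 6 - 1 / 4)) := by
  have hv : Tendsto (fun h : ℝ => (k * h * t : ℂ)) (𝓝[>] 0) (𝓝 0) := by
    have : Tendsto (fun h : ℝ => (k * h * t : ℂ)) (𝓝 0) (𝓝 (k * (0 : ℝ) * t)) :=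
      (by fun_prop : Continuous fun h : ℝ => (k * h * t : ℂ)).tendsto 0
    simpa using this.mono_left nhdsWithin_le_nhds
  have h1 : Tendsto (fun h : ℝ => (((1 / Real.log (1 + h ^ 3) - 1 / h ^ 3 : ℝ)) : ℂ)) (𝓝[>] 0)
      (𝓝 ((1 / 2 : ℝ) : ℂ)) :=
    (Complex.continuous_ofReal.tendsto _).comp
      (tendsto_inv_log_one_add_sub_inv.comp (tendsto_pow_nhdsGT_zero three_ne_zero))
  have h2 : Tendsto (fun h : ℝ => (((√(1 + h ^ 3) - 1) / h ^ 3 : ℝ) : ℂ)) (𝓝[>] 0)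
      (𝓝 ((1 / 2 : ℝ) : ℂ)) := by
    refine (Complex.continuous_ofReal.tendsto _).comp ?_
    have h := hasDerivAt_sqrt_one_add_zero.tendsto_slope_zero_right.comp
      (tendsto_pow_nhdsGT_zero three_ne_zero)
    refine h.congr fun h => ?_
    simp [div_eq_inv_mul]
  have h3 : Tendsto (fun h : ℝ => (1 - k * h * t + (k * h * t) ^ 2 / 2 -
      Complex.exp (-(k * h * t)) : ℂ) / (h : ℂ) ^ 3) (𝓝[>] 0) (𝓝 ((k * t) ^ 3 / 6)) := by
    rw [tendsto_iff_norm_sub_tendsto_zero]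
    have h0 : Tendsto (fun h : ℝ => ‖(k * t : ℂ)‖ ^ 4 * h * Real.exp (‖(k * t : ℂ)‖ * h))
        (𝓝[>] 0) (𝓝 0) := by
      have : Tendsto (fun h : ℝ => ‖(k * t : ℂ)‖ ^ 4 * h * Real.exp (‖(k * t : ℂ)‖ * h)) (𝓝 0)
          (𝓝 (‖(k * t : ℂ)‖ ^ 4 * 0 * Real.exp (‖(k * t : ℂ)‖ * 0))) :=
        (by fun_prop : Continuous fun h : ℝ =>
          ‖(k * t : ℂ)‖ ^ 4 * h * Real.exp (‖(k * t : ℂ)‖ * h)).tendsto 0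
      simpa using this.mono_left nhdsWithin_le_nhds
    refine squeeze_zero' (Eventually.of_forall fun w => norm_nonneg _) ?_ h0
    filter_upwards [self_mem_nhdsWithin] with h hh
    have hh : 0 < h := hh
    have hhc : (h : ℂ) ≠ 0 := by exact_mod_cast hh.ne'
    have hb := Complex.norm_exp_sub_sum_le_norm_mul_exp (-(k * h * t)) 4
    have hn : ‖-(k * h * t : ℂ)‖ = ‖(k * t : ℂ)‖ * h := by
      rw [norm_neg, show (k * h * t : ℂ) = k * t * h by ring, norm_mul _ (h : ℂ),
        Complex.norm_real, Real.norm_of_nonneg hh.le]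
    rw [hn] at hb
    rw [show (1 - k * h * t + (k * h * t) ^ 2 / 2 - Complex.exp (-(k * h * t)) : ℂ) / (h : ℂ) ^ 3 -
      (k * t) ^ 3 / 6 = -((Complex.exp (-(k * h * t)) -
        ∑ m ∈ Finset.range 4, (-(k * h * t)) ^ m / (m.factorial : ℂ)) / (h : ℂ) ^ 3) by
      simp only [Finset.sum_range_succ, Finset.sum_range_zero, Nat.factorial]
      push_cast
      field_simp
      ring, norm_neg, norm_div, norm_pow, Complex.norm_real, Real.norm_of_nonneg hh.le,
      div_le_iff₀ (by positivity)]
    refine hb.trans (le_of_eq ?_)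
    ring
  have h4 : Tendsto (fun h : ℝ => (k * h * t - 1 : ℂ) ^ 2 / 2) (𝓝[>] 0) (𝓝 ((0 - 1) ^ 2 / 2)) :=
    ((hv.sub_const 1).pow 2).div_const 2
  have h5 : Tendsto (fun h : ℝ => Complex.exp (-(k * h * t))) (𝓝[>] 0) (𝓝 (Complex.exp (-0))) :=
    (Complex.continuous_exp.tendsto _).comp hv.neg
  have h6 := ((h4.mul h1).add h3).sub (h2.mul h5)
  have hlim : (0 - 1 : ℂ) ^ 2 / 2 * ((1 / 2 : ℝ) : ℂ) + (k * t) ^ 3 / 6 -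
      ((1 / 2 : ℝ) : ℂ) * Complex.exp (-0) = (k * t) ^ 3 / 6 - 1 / 4 := by
    rw [neg_zero, Complex.exp_zero]
    push_cast
    ring
  rw [hlim] at h6
  refine h6.congr' ?_
  filter_upwards [self_mem_nhdsWithin] with h hh
  have hh : 0 < h := hh
  have hhc : (h : ℂ) ≠ 0 := by exact_mod_cast hh.ne'
  have hLc : (Real.log (1 + h ^ 3) : ℂ) ≠ 0 := by
    exact_mod_cast (Real.log_pos (by linarith [pow_pos hh 3])).ne'
  simp only [saddleExponent]
  push_cast
  field_simp
  ring

theorem re_saddle_le {k h : ℝ} (hk : 0 < k) (hh : 0 < h)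
    (hq : √(1 + h ^ 3) * Real.exp (-(k * h / 2)) ≤ 1 - h / 4) (τ : ℂ) (s : ℝ) :
    (saddleExponent k h (1 / 2 + s * Complex.I) + τ * saddleSlope k h (1 / 2 + s * Complex.I)).re ≤
      (saddleExponent k h (1 / 2) + τ * saddleSlope k h (1 / 2)).re + k * ‖τ‖ * |s| -
        k ^ 2 / 8 * s ^ 2 := by
  set L := Real.log (1 + h ^ 3) with hL_def
  set q := √(1 + h ^ 3) * Real.exp (-(k * h / 2)) with hq_def
  set y := k * h * s with hy
  have hL : 0 < L := Real.log_pos (by linarith [pow_pos hh 3])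
  have hLh : L ≤ h ^ 3 := by
    have := Real.log_le_sub_one_of_pos (x := 1 + h ^ 3) (by positivity)
    linarith
  have hq0 : 0 ≤ q := by positivity
  have hhc : (h : ℂ) ≠ 0 := by exact_mod_cast hh.ne'
  have hLc : (L : ℂ) ≠ 0 := by exact_mod_cast hL.ne'
  have hexp0 : (√(1 + h ^ 3) : ℂ) * Complex.exp (-(k * h * (1 / 2))) = (q : ℂ) := by
    rw [hq_def]
    push_cast
    ring_nf
  have hexp : (√(1 + h ^ 3) : ℂ) * Complex.exp (-(k * h * (1 / 2 + s * Complex.I))) =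
      (q : ℂ) * Complex.exp (Complex.I * ((-y : ℝ) : ℂ)) := by
    rw [← hexp0, mul_assoc (_ : ℂ) (Complex.exp _), ← Complex.exp_add, hy]
    push_cast
    ring_nf
  have hdiff : saddleExponent k h (1 / 2 + s * Complex.I) +
      τ * saddleSlope k h (1 / 2 + s * Complex.I)
      - (saddleExponent k h (1 / 2) + τ * saddleSlope k h (1 / 2)) =
      ((-y ^ 2 / (2 * L) : ℝ) : ℂ) + (((k * h / 2 - 1) * y / L : ℝ) : ℂ) * Complex.I -
        ((q / h ^ 3 : ℝ) : ℂ) * (Complex.exp (Complex.I * ((-y : ℝ) : ℂ)) - 1) +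
        τ * (((q / h : ℝ) : ℂ) * (Complex.exp (Complex.I * ((-y : ℝ) : ℂ)) - 1)) := by
    simp only [saddleExponent, saddleSlope, hexp, hexp0, ← hL_def]
    rw [show (k * h * (1 / 2 + s * Complex.I) - 1 : ℂ) ^ 2 = (k * h / 2 - 1) ^ 2 +
      2 * (k * h / 2 - 1) * (k * h * s) * Complex.I - (k * h * s) ^ 2 by
        linear_combination ((k * h * s : ℂ) ^ 2) * Complex.I_sq, hy]
    push_cast
    field_simp
    ring
  have hnorm : ‖Complex.exp (Complex.I * ((-y : ℝ) : ℂ)) - 1‖ ≤ |y| := by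
    simpa using Real.norm_exp_I_mul_ofReal_sub_one_le (x := -y)
  have hτ : (τ * (((q / h : ℝ) : ℂ) * (Complex.exp (Complex.I * ((-y : ℝ) : ℂ)) - 1))).re ≤
      k * ‖τ‖ * |s| := by
    refine (Complex.re_le_norm _).trans ?_
    rw [norm_mul, norm_mul, Complex.norm_real, Real.norm_of_nonneg (by positivity)]
    have hy' : |y| = k * h * |s| := by rw [hy, abs_mul, abs_of_pos (by positivity)]
    calc ‖τ‖ * (q / h * ‖Complex.exp (Complex.I * ((-y : ℝ) : ℂ)) - 1‖)
        ≤ ‖τ‖ * (1 / h * |y|) := by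
          gcongr
          linarith
      _ = k * ‖τ‖ * |s| := by
          rw [hy']
          field_simp
  have hre : (Complex.exp (Complex.I * ((-y : ℝ) : ℂ))).re = Real.cos y := by
    rw [mul_comm, Complex.exp_ofReal_mul_I_re, Real.cos_neg]
  have hcos : q / h ^ 3 * (1 - Real.cos y) ≤ (1 - h / 4) / h ^ 3 * (y ^ 2 / 2) := by
    have := Real.one_sub_sq_div_two_le_cos (x := y)
    have := Real.cos_le_one y
    have h1 : 0 ≤ 1 - h / 4 := hq0.trans hq
    gcongr
    linarith
  have hquad : y ^ 2 / (2 * h ^ 3) ≤ y ^ 2 / (2 * L) := by gcongr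
  have hfin : (1 - h / 4) / h ^ 3 * (y ^ 2 / 2) - y ^ 2 / (2 * h ^ 3) = -(k ^ 2 / 8 * s ^ 2) := by
    rw [hy]
    field_simp
    ring
  have hmain := congrArg Complex.re hdiff
  simp only [Complex.add_re _ (τ * (_ * _)), Complex.sub_re, Complex.re_ofReal_mul, Complex.add_re,
    Complex.ofReal_re, hre, Complex.one_re, Complex.I_re, mul_zero] at hmain hτ ⊢
  have : -y ^ 2 / (2 * L) = -(y ^ 2 / (2 * L)) := by ring
  linarith

theorem tendsto_sqrt_div_log :
    Tendsto (fun h : ℝ => √(h ^ 3 / Real.log (1 + h ^ 3))) (𝓝[>] 0) (𝓝 1) := by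
  have hw : Tendsto (fun w : ℝ => √(w / Real.log (1 + w))) (𝓝[>] 0) (𝓝 1) := by
    have hid : Tendsto (fun w : ℝ => w) (𝓝[>] 0) (𝓝 0) := nhdsWithin_le_nhds
    have h := ((hid.mul tendsto_inv_log_one_add_sub_inv).const_add 1).sqrt
    simp only [zero_mul, add_zero, Real.sqrt_one] at h
    refine h.congr' ?_
    filter_upwards [self_mem_nhdsWithin] with w hw
    have hw0 : 0 < w := hw
    have hL : 0 < Real.log (1 + w) := Real.log_pos (by linarith)
    congr 1
    field_simp
    ring
  exact hw.comp (tendsto_pow_nhdsGT_zero three_ne_zero)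

/-- The rescaled exponent converges to the Airy exponent, uniformly for bounded `τ`. -/
theorem tendsto_saddle_sub {k : ℝ} (hk3 : k ^ 3 = 2) {S : Set ℂ} {M : ℝ} (hM : ∀ τ ∈ S, ‖τ‖ ≤ M)
    (t : ℂ) :
    Tendsto (fun p : ℝ × ℂ => saddleExponent k p.1 t + p.2 * saddleSlope k p.1 t + 1 / 4 -
      (-(k * p.2) * t + t ^ 3 / 3)) (𝓝[>] 0 ×ˢ 𝓟 S) (𝓝 0) := by
  have hk3c : (k : ℂ) ^ 3 = 2 := by exact_mod_cast hk3
  have h0 := ((tendsto_saddleExponent k t).comp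
    (tendsto_fst (f := 𝓝[>] (0 : ℝ)) (g := 𝓟 S))).sub_const
    ((k * t : ℂ) ^ 3 / 6 - 1 / 4)
  have h1 := ((tendsto_saddleSlope k t).comp (tendsto_fst (f := 𝓝[>] (0 : ℝ)) (g := 𝓟 S))).sub_const
    (-(k * t : ℂ))
  rw [sub_self] at h0 h1
  have h2 : Tendsto (fun p : ℝ × ℂ => p.2 * (saddleSlope k p.1 t - -(k * t))) (𝓝[>] 0 ×ˢ 𝓟 S)
      (𝓝 0) := by
    refine squeeze_zero_norm' (a := fun p : ℝ × ℂ => M * ‖saddleSlope k p.1 t - -(k * t)‖) ?_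
      (by simpa using h1.norm.const_mul M)
    filter_upwards [tendsto_snd (mem_principal_self S)] with p hp
    rw [norm_mul]
    exact mul_le_mul_of_nonneg_right (hM _ hp) (norm_nonneg _)
  refine (by simpa using h0.add h2 : Tendsto _ _ (𝓝 (0 : ℂ))).congr fun p => ?_
  linear_combination (-(t ^ 3 / 6)) * hk3c

theorem eventually_sqrt_mul_exp_le {k : ℝ} (hk : 1 ≤ k) :
    ∀ᶠ h : ℝ in 𝓝[>] 0, √(1 + h ^ 3) * Real.exp (-(k * h / 2)) ≤ 1 - h / 4 := by
  have h := (Complex.continuous_re.tendsto _).comp (tendsto_saddleSlope k (1 / 2))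
  have hlt : (-(k * (1 / 2) : ℂ)).re < -(1 / 4) := by
    rw [show (-(k * (1 / 2) : ℂ)) = ((-(k / 2) : ℝ) : ℂ) by push_cast; ring, Complex.ofReal_re]
    linarith
  filter_upwards [h.eventually_lt_const hlt, self_mem_nhdsWithin] with h hlt hh
  have hh : 0 < h := hh
  rw [Function.comp_apply, saddleSlope,
    show ((√(1 + h ^ 3) : ℂ) * Complex.exp (-(k * h * (1 / 2))) - 1) / (h : ℂ) =
      (((√(1 + h ^ 3) * Real.exp (-(k * h / 2)) - 1) / h : ℝ) : ℂ) by push_cast; ring_nf,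
    Complex.ofReal_re, div_lt_iff₀ hh] at hlt
  linarith

theorem continuous_saddle (k h : ℝ) (τ : ℂ) : Continuous fun s : ℝ =>
    Complex.exp (saddleExponent k h (1 / 2 + s * Complex.I) +
      τ * saddleSlope k h (1 / 2 + s * Complex.I)) := by
  unfold saddleExponent saddleSlope
  fun_prop

theorem eventually_norm_exp_saddle_le {k : ℝ} (hk : 1 ≤ k) (hk3 : k ^ 3 = 2) {S : Set ℂ} {M : ℝ}
    (hM : ∀ τ ∈ S, ‖τ‖ ≤ M) :
    ∀ᶠ p : ℝ × ℂ in 𝓝[>] 0 ×ˢ 𝓟 S, ∀ s : ℝ,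
      ‖Complex.exp (saddleExponent k p.1 (1 / 2 + s * Complex.I) +
        p.2 * saddleSlope k p.1 (1 / 2 + s * Complex.I))‖ ≤
      Real.exp (k * M + 2 + k * M * |s| - 1 / 8 * s ^ 2) := by
  have hD := (tendsto_saddle_sub hk3 hM (1 / 2)).norm
  rw [norm_zero] at hD
  filter_upwards [hD.eventually_lt_const one_pos, tendsto_snd (mem_principal_self S),
    tendsto_fst.eventually (eventually_sqrt_mul_exp_le hk),
    tendsto_fst.eventually (self_mem_nhdsWithin (a := (0 : ℝ)) (s := Set.Ioi 0))]
    with p hp hpS hq hh s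
  have hτ : ‖p.2‖ ≤ M := hM _ hpS
  rw [Complex.norm_exp, Real.exp_le_exp]
  refine (re_saddle_le (by linarith) hh hq p.2 s).trans ?_
  have h1 := (Complex.re_le_norm _).trans hp.le
  have h2 : (-(k * p.2) * (1 / 2) + (1 / 2) ^ 3 / 3 - 1 / 4 : ℂ).re ≤ k * M := by
    rw [show (-(k * p.2) * (1 / 2) + (1 / 2) ^ 3 / 3 - 1 / 4 : ℂ) =
      ((k / 2 : ℝ) : ℂ) * -p.2 + ((-5 / 24 : ℝ) : ℂ) by push_cast; ring, Complex.add_re,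
      Complex.re_ofReal_mul, Complex.ofReal_re]
    have := (Complex.re_le_norm (-p.2)).trans_eq (norm_neg _)
    nlinarith [norm_nonneg p.2]
  have h3 : (saddleExponent k p.1 (1 / 2) + p.2 * saddleSlope k p.1 (1 / 2)).re ≤ k * M + 1 := by
    rw [show saddleExponent k p.1 (1 / 2) + p.2 * saddleSlope k p.1 (1 / 2) =
      (saddleExponent k p.1 (1 / 2) + p.2 * saddleSlope k p.1 (1 / 2) + 1 / 4 -
      (-(k * p.2) * (1 / 2) + (1 / 2) ^ 3 / 3)) +
      (-(k * p.2) * (1 / 2) + (1 / 2) ^ 3 / 3 - 1 / 4) by ring, Complex.add_re]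
    linarith
  have h4 : k * ‖p.2‖ * |s| ≤ k * M * |s| := by gcongr
  nlinarith [sq_nonneg s, mul_nonneg (by nlinarith : (0 : ℝ) ≤ k ^ 2 - 1) (sq_nonneg s)]

/-- The rescaled integral converges to the Airy integral, uniformly for bounded `τ`. -/
theorem tendsto_integral_saddle_sub {k : ℝ} (hk : 1 ≤ k) (hk3 : k ^ 3 = 2) {S : Set ℂ} {M : ℝ}
    (hM : ∀ τ ∈ S, ‖τ‖ ≤ M) :
    Tendsto (fun p : ℝ × ℂ =>
      (√(p.1 ^ 3 / Real.log (1 + p.1 ^ 3)) : ℂ) * (Complex.exp (1 / 4) * ∫ s : ℝ,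
        Complex.exp (saddleExponent k p.1 (1 / 2 + s * Complex.I) +
          p.2 * saddleSlope k p.1 (1 / 2 + s * Complex.I))) -
      ∫ s : ℝ, Complex.exp (-(k * p.2) * (1 / 2 + s * Complex.I) + (1 / 2 + s * Complex.I) ^ 3 / 3))
      (𝓝[>] 0 ×ˢ 𝓟 S) (𝓝 0) := by
  set ρ : ℝ → ℝ := fun h => √(h ^ 3 / Real.log (1 + h ^ 3)) with hρ_def
  set A : ℝ × ℂ → ℝ → ℂ := fun p s => Complex.exp (saddleExponent k p.1 (1 / 2 + s * Complex.I) +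
    p.2 * saddleSlope k p.1 (1 / 2 + s * Complex.I)) with hA
  set B : ℝ × ℂ → ℝ → ℂ := fun p s => Complex.exp (-(k * p.2) * (1 / 2 + s * Complex.I) +
    (1 / 2 + s * Complex.I) ^ 3 / 3) with hB
  have hρ : Tendsto (fun p : ℝ × ℂ => ρ p.1) (𝓝[>] 0 ×ˢ 𝓟 S) (𝓝 1) :=
    tendsto_sqrt_div_log.comp tendsto_fst
  have hAc : ∀ p, Continuous (A p) := fun p => continuous_saddle k p.1 p.2
  have hBc : ∀ p, Continuous (B p) := fun p => continuous_airyLine _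
  have hBle : ∀ p : ℝ × ℂ, p.2 ∈ S → ∀ s,
      ‖B p s‖ ≤ Real.exp (k * M + 1 + k * M * |s| - 1 / 2 * s ^ 2) := by
    intro p hp s
    refine (norm_airyLine_le _ s).trans (Real.exp_le_exp.2 ?_)
    have hz : ‖(k * p.2 : ℂ)‖ ≤ k * M := by
      rw [norm_mul, Complex.norm_real, Real.norm_of_nonneg (by linarith)]
      exact mul_le_mul_of_nonneg_left (hM _ hp) (by linarith)
    gcongr
  have hAle := eventually_norm_exp_saddle_le hk hk3 hM
  have hbound := integrable_exp_sub_mul_sq (k * M + 2) (k * M) (c := 1 / 8) (by norm_num)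
  have hint : Tendsto (fun p => ∫ s, ((ρ p.1 : ℂ) * (Complex.exp (1 / 4) * A p s) - B p s))
      (𝓝[>] 0 ×ˢ 𝓟 S) (𝓝 (∫ _ : ℝ, (0 : ℂ))) := by
    refine tendsto_integral_filter_of_dominated_convergence
      (fun s => 2 * (Real.exp (1 / 4) * Real.exp (k * M + 2 + k * M * |s| - 1 / 8 * s ^ 2)) +
        Real.exp (k * M + 1 + k * M * |s| - 1 / 2 * s ^ 2)) ?_ ?_ ?_ ?_
    · exact Eventually.of_forall fun p => ((continuous_const.mul (continuous_const.mul
        (hAc p))).sub (hBc p)).aestronglyMeasurable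
    · filter_upwards [hAle, tendsto_snd (mem_principal_self S),
        hρ.eventually_lt_const one_lt_two] with p hp hpS hρp
      refine ae_of_all _ fun s => (norm_sub_le _ _).trans (add_le_add ?_ (hBle p hpS s))
      rw [norm_mul, norm_mul, Complex.norm_real, Real.norm_of_nonneg (Real.sqrt_nonneg _),
        Complex.norm_exp]
      have h14 : (1 / 4 : ℂ).re = 1 / 4 := by norm_num
      rw [h14]
      gcongr
      exact hp s
    · exact ((hbound.const_mul _).const_mul _).add
        (integrable_exp_sub_mul_sq (k * M + 1) (k * M) (by norm_num))
    · refine ae_of_all _ fun s => ?_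
      have hD := (Complex.continuous_exp.tendsto _).comp
        (tendsto_saddle_sub hk3 hM (1 / 2 + s * Complex.I))
      have hρc := (Complex.continuous_ofReal.tendsto _).comp hρ
      have h0 := ((hρc.mul hD).sub_const 1).norm
      simp only [Complex.ofReal_one, Complex.exp_zero, mul_one, sub_self, norm_zero,
        Function.comp_apply] at h0
      have h0' := h0.const_mul (Real.exp (k * M + 1 + k * M * |s| - 1 / 2 * s ^ 2))
      rw [mul_zero] at h0'
      refine squeeze_zero_norm' ?_ h0'
      filter_upwards [tendsto_snd (mem_principal_self S)] with p hpS
      have hfac : (ρ p.1 : ℂ) * (Complex.exp (1 / 4) * A p s) - B p s = B p s * ((ρ p.1 : ℂ) *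
          Complex.exp (saddleExponent k p.1 (1 / 2 + s * Complex.I) +
          p.2 * saddleSlope k p.1 (1 / 2 + s * Complex.I) + 1 / 4 -
          (-(k * p.2) * (1 / 2 + s * Complex.I) + (1 / 2 + s * Complex.I) ^ 3 / 3)) - 1) := by
        have : B p s * Complex.exp (saddleExponent k p.1 (1 / 2 + s * Complex.I) +
            p.2 * saddleSlope k p.1 (1 / 2 + s * Complex.I) + 1 / 4 -
            (-(k * p.2) * (1 / 2 + s * Complex.I) + (1 / 2 + s * Complex.I) ^ 3 / 3)) =
            Complex.exp (1 / 4) * A p s := by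
          rw [hA, hB, ← Complex.exp_add, ← Complex.exp_add]
          ring_nf
        linear_combination (-(ρ p.1 : ℂ)) * this
      rw [hfac, norm_mul]
      exact mul_le_mul_of_nonneg_right (hBle p hpS s) (norm_nonneg _)
  rw [integral_zero] at hint
  refine hint.congr' ?_
  filter_upwards [hAle] with p hp
  have hAi : Integrable (A p) := hbound.mono' (hAc p).aestronglyMeasurable (ae_of_all _ hp)
  rw [integral_sub ((hAi.const_mul _).const_mul _) (integrable_airyLine _), integral_const_mul,
    integral_const_mul]

/-- Part (c) of the analytic lemma for `φ̃`, uniformly on compact `τ`-sets: with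
`z(τ,w) = (1 − τw^{2/3})/(ew)`,
`φ̃ = √(2π) 2^{1/3} w^{−1/6} e^{−1/4} (Ai(2^{1/3}τ) + η(τ,w)) e^{−1/(2w) + τ/w^{1/3}}`
where `η → 0` uniformly on `S` as `w → 0⁺`. -/
theorem phiTilde_uniform_part_c (S : Set ℂ) (hS : IsCompact S) :
    ∃ η : ℂ → ℝ → ℂ,
      (∀ᶠ w in 𝓝[>] (0 : ℝ), ∀ τ ∈ S,
        phiTilde ((1 - τ * ((w ^ ((2 : ℝ) / 3) : ℝ) : ℂ)) / ((Real.exp 1 * w : ℝ) : ℂ)) w =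
          (Real.sqrt (2 * Real.pi) : ℂ) * (2 : ℂ) ^ ((1 : ℂ) / 3) *
            ((w ^ (-(1 : ℝ) / 6) : ℝ) : ℂ) * ((Real.exp (-(1 : ℝ) / 4) : ℝ) : ℂ) *
            (airyAi ((2 : ℂ) ^ ((1 : ℂ) / 3) * τ) + η τ w) *
            Complex.exp (-1 / (2 * (w : ℂ)) + τ / ((w ^ ((1 : ℝ) / 3) : ℝ) : ℂ))) ∧
      TendstoUniformlyOn (fun w τ => η τ w) 0 (𝓝[>] (0 : ℝ)) S := by

  set k : ℝ := (2 : ℝ) ^ ((1 : ℝ) / 3) with hk_def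
  have hk1 : 1 ≤ k := Real.one_le_rpow (by norm_num) (by norm_num)
  have hk3 : k ^ 3 = 2 := by
    rw [hk_def, ← Real.rpow_natCast, ← Real.rpow_mul (by norm_num)]
    norm_num
  have hkc : (2 : ℂ) ^ ((1 : ℂ) / 3) = (k : ℂ) := by
    rw [hk_def, Complex.ofReal_cpow (by norm_num)]
    norm_num
  obtain ⟨M, hM⟩ := hS.isBounded.exists_norm_le
  have hlim := (tendsto_integral_saddle_sub hk1 hk3 hM).const_mul (1 / (2 * (Real.pi : ℂ)))
  rw [mul_zero] at hlim
  have hroot : Tendsto (fun w : ℝ => w ^ ((1 : ℝ) / 3)) (𝓝[>] 0) (𝓝[>] 0) := by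
    refine tendsto_nhdsWithin_iff.2 ⟨?_, ?_⟩
    · have h := (Real.continuousAt_rpow_const (0 : ℝ) ((1 : ℝ) / 3) (Or.inr (by norm_num))).tendsto
      rw [Real.zero_rpow (by norm_num)] at h
      exact h.mono_left nhdsWithin_le_nhds
    · filter_upwards [self_mem_nhdsWithin] with w hw
      exact Real.rpow_pos_of_pos hw _
  refine ⟨fun τ w => 1 / (2 * (Real.pi : ℂ)) *
      ((√((w ^ ((1 : ℝ) / 3)) ^ 3 / Real.log (1 + (w ^ ((1 : ℝ) / 3)) ^ 3)) : ℂ) *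
        (Complex.exp (1 / 4) * ∫ s : ℝ,
          Complex.exp (saddleExponent k (w ^ ((1 : ℝ) / 3)) (1 / 2 + s * Complex.I) +
            τ * saddleSlope k (w ^ ((1 : ℝ) / 3)) (1 / 2 + s * Complex.I))) -
      ∫ s : ℝ, Complex.exp (-(k * τ) * (1 / 2 + s * Complex.I) +
        (1 / 2 + s * Complex.I) ^ 3 / 3)), ?_, Metric.tendstoUniformlyOn_iff.2 fun ε hε => ?_⟩
  rotate_left
  · have h := (hlim.comp (hroot.prodMap (tendsto_id (x := 𝓟 S)))).norm
    rw [norm_zero] at h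
    have h' := eventually_prod_principal_iff.1 (h.eventually_lt_const hε)
    filter_upwards [h'] with w hw τ hτ
    rw [Pi.zero_apply, dist_zero_left]
    exact hw τ hτ
  · filter_upwards [self_mem_nhdsWithin] with w hw τ _
    have hw : 0 < w := hw
    set h : ℝ := w ^ ((1 : ℝ) / 3) with hh_def
    have hh : 0 < h := Real.rpow_pos_of_pos hw _
    have hwh : w = h ^ 3 := by
      rw [hh_def, ← Real.rpow_natCast, ← Real.rpow_mul hw.le]
      norm_num
    have hw23 : w ^ ((2 : ℝ) / 3) = h ^ 2 := by
      rw [hh_def, ← Real.rpow_natCast, ← Real.rpow_mul hw.le]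
      norm_num
    have hw16 : w ^ (-(1 : ℝ) / 6) = h / √(h ^ 3) := by
      rw [← hwh, Real.sqrt_eq_rpow, hh_def, ← Real.rpow_sub hw]
      norm_num
    have hL : 0 < Real.log (1 + h ^ 3) := Real.log_pos (by linarith [pow_pos hh 3])
    rw [hw16, hw23, hkc, airyAi_eq_integral_line, hwh, Complex.ofReal_pow h 2,
      phiTilde_eq_integral_saddle (by linarith : 0 < k) hh τ, ← mul_add, add_sub_cancel,
      Real.sqrt_div (by positivity), Real.sqrt_mul (by positivity)]
    have hexp : ((Real.exp (-(1 : ℝ) / 4) : ℝ) : ℂ) * Complex.exp (1 / 4) = 1 := by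
      rw [Complex.ofReal_exp, ← Complex.exp_add]
      norm_num
    have h2pi : (√(2 * Real.pi) : ℂ) ^ 2 = 2 * Real.pi := by
      rw [← Complex.ofReal_pow, Real.sq_sqrt (by positivity)]
      push_cast
      ring
    have hs1 : (√(2 * Real.pi) : ℂ) ≠ 0 := by
      exact_mod_cast (Real.sqrt_pos.2 (by positivity)).ne'
    have hs2 : (√(h ^ 3) : ℂ) ≠ 0 := by exact_mod_cast (Real.sqrt_pos.2 (by positivity)).ne'
    have hs3 : (√(Real.log (1 + h ^ 3)) : ℂ) ≠ 0 := by exact_mod_cast (Real.sqrt_pos.2 hL).ne'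
    rw [← h2pi]
    push_cast at hexp ⊢
    generalize (∫ s : ℝ, _ : ℂ) = J
    generalize Complex.exp (_ + τ / _) = X
    generalize Complex.exp (-1 / 4) = e at hexp ⊢
    generalize Complex.exp (1 / 4) = e' at hexp ⊢
    field_simp
    linear_combination (-(k * h * J * X)) * hexp
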